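/- Let T be a tree with order n and domination number gamma, where 1 <= gamma < ceil(n/3). If gamma is odd, then s(T) <= ((3*gamma - 1)/2) * (n - (3*gamma - 1)/2); if gamma is even, then s(T) <= (3*gamma/2) * (n + 1 - 3*gamma/2) - ceil(n/2). In both cases equality holds if and only if T is isomorphic to the dumbbell D_n(ceil((n - 3*gamma + 2)/2), floor((n - 3*gamma + 2)/2)). -/

import Mathlib

open SimpleGraph

variable {V : Type*}

/-- The status of a vertex: sum of distances to all other vertices. -/
noncomputable def status [Fintype V] (G : SimpleGraph V) (u : V) : ℕ :=
  ∑ v : V, G.dist u v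

/-- The minimum status of a graph. -/
noncomputable def minStatus [Fintype V] (G : SimpleGraph V) : ℕ :=
  sInf (Set.range (status G))

/-- The matching number: maximum cardinality of a matching. -/
noncomputable def matchingNumber (G : SimpleGraph V) : ℕ :=
  sSup {k | ∃ M : G.Subgraph, M.IsMatching ∧ M.edgeSet.ncard = k}

/-- The domination number: minimum cardinality of a dominating set. -/
noncomputable def domNumber (G : SimpleGraph V) : ℕ :=
  sInf {k | ∃ S : Set V, (∀ v ∉ S, ∃ u ∈ S, G.Adj u v) ∧ S.ncard = k}

/-- The dumbbell `D_n(p,q)`: a path on `n - p - q` vertices `0, …, n-p-q-1`,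
with `p` pendant vertices attached to vertex `0` and `q` pendant vertices
attached to vertex `n-p-q-1`. -/
def dumbbell (n p q : ℕ) : SimpleGraph (Fin n) :=
  SimpleGraph.fromRel (fun a b =>
    ((a : ℕ) + 1 = (b : ℕ) ∧ (b : ℕ) < n - p - q) ∨
    ((a : ℕ) = 0 ∧ n - p - q ≤ (b : ℕ) ∧ (b : ℕ) < n - q) ∨
    ((a : ℕ) = n - p - q - 1 ∧ n - q ≤ (b : ℕ)))

/-- The tree `A_{n,m}`: a star with center `0` and leaves `1, …, n-m`, with one
pendant vertex `n-m+i` attached to leaf `i` for each `i = 1, …, m-1`. -/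
def treeA (n m : ℕ) : SimpleGraph (Fin n) :=
  SimpleGraph.fromRel (fun a b =>
    ((a : ℕ) = 0 ∧ 1 ≤ (b : ℕ) ∧ (b : ℕ) ≤ n - m) ∨
    (1 ≤ (a : ℕ) ∧ (a : ℕ) ≤ m - 1 ∧ (b : ℕ) = n - m + (a : ℕ)))

/-- The caterpillar `C_n(p,q)`: a path on vertices `0, …, n-p-q-1`; pendant
vertex `n-p-q+j` is attached to path vertex `j` for `j = 0, …, p-1`, and pendant
vertex `n-q+j` is attached to path vertex `n-p-2q+j` for `j = 0, …, q-1`. -/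
def caterpillar (n p q : ℕ) : SimpleGraph (Fin n) :=
  SimpleGraph.fromRel (fun a b =>
    ((a : ℕ) + 1 = (b : ℕ) ∧ (b : ℕ) < n - p - q) ∨
    (n - p - q ≤ (b : ℕ) ∧ (b : ℕ) < n - q ∧ (a : ℕ) = (b : ℕ) - (n - p - q)) ∨
    (n - q ≤ (b : ℕ) ∧ (a : ℕ) = (b : ℕ) - p - q))

/-- In a tree, a vertex has at most one neighbour that is closer to a given vertex. -/
lemma SimpleGraph.IsTree.eq_of_adj_of_dist_eq {T : SimpleGraph V} (hT : T.IsTree) {w u a b : V}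
    (ha : T.Adj a u) (hb : T.Adj b u) (hda : T.dist w u = T.dist w a + 1)
    (hdb : T.dist w u = T.dist w b + 1) : a = b := by
  obtain ⟨p, hp⟩ := hT.connected.exists_walk_length_eq_dist w a
  obtain ⟨q, hq⟩ := hT.connected.exists_walk_length_eq_dist w b
  have hp' : (p.concat ha).IsPath :=
    (p.concat ha).isPath_of_length_eq_dist (by rw [Walk.length_concat]; omega)
  have hq' : (q.concat hb).IsPath :=
    (q.concat hb).isPath_of_length_eq_dist (by rw [Walk.length_concat]; omega)
  have h := (hT.existsUnique_path w u).unique hp' hq'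
  simpa using congrArg Walk.penultimate h

/-- `v 0, …, v d` is a geodesic of `G`: distances along it are differences of indices. -/
def IsGeodesic (G : SimpleGraph V) (d : ℕ) (v : ℕ → V) : Prop :=
  ∀ i j, i ≤ j → j ≤ d → G.dist (v i) (v j) = j - i

/-- Any two vertices of a connected graph are joined by a geodesic. -/
lemma SimpleGraph.Connected.exists_isGeodesic {G : SimpleGraph V} (hG : G.Connected) (x y : V) :
    ∃ v : ℕ → V, v 0 = x ∧ v (G.dist x y) = y ∧ IsGeodesic G (G.dist x y) v := by
  obtain ⟨p, hp⟩ := hG.exists_walk_length_eq_dist x y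
  have h0 : p.getVert 0 = x := p.getVert_zero
  have hd : p.getVert (G.dist x y) = y := hp ▸ p.getVert_length
  have hle : ∀ i k, i + k ≤ G.dist x y → G.dist (p.getVert i) (p.getVert (i + k)) ≤ k := by
    intro i k
    induction k with
    | zero => simp
    | succ k ih =>
      intro h
      have h1 := dist_eq_one_iff_adj.2 (p.adj_getVert_succ (i := i + k) (by omega))
      have := hG.dist_triangle (u := p.getVert i) (v := p.getVert (i + k))
        (w := p.getVert (i + k + 1))
      have := ih (by omega)
      rw [← add_assoc]
      omega
  refine ⟨p.getVert, h0, hd, fun i j hij hj => ?_⟩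
  have h1 := hle 0 i (by omega)
  have h2 := hle i (j - i) (by omega)
  have h3 := hle j (G.dist x y - j) (by omega)
  rw [zero_add, h0] at h1
  rw [show i + (j - i) = j by omega] at h2
  rw [show j + (G.dist x y - j) = G.dist x y by omega, hd] at h3
  have h4 := hG.dist_triangle (u := x) (v := p.getVert i) (w := y)
  have h5 := hG.dist_triangle (u := p.getVert i) (v := p.getVert j) (w := y)
  omega

lemma IsGeodesic.adj {G : SimpleGraph V} {d : ℕ} {v : ℕ → V} (hv : IsGeodesic G d v) {i : ℕ}
    (hi : i < d) : G.Adj (v i) (v (i + 1)) :=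
  dist_eq_one_iff_adj.1 (by rw [hv i (i + 1) (by omega) hi]; omega)

lemma IsGeodesic.dist_eq {G : SimpleGraph V} {d : ℕ} {v : ℕ → V} (hv : IsGeodesic G d v)
    {i j : ℕ} (hi : i ≤ d) (hj : j ≤ d) : G.dist (v i) (v j) = (i - j) + (j - i) := by
  rcases le_total i j with h | h
  · rw [hv i j h hj]; omega
  · rw [dist_comm, hv j i h hi]; omega

lemma IsGeodesic.injOn {G : SimpleGraph V} {d : ℕ} {v : ℕ → V} (hv : IsGeodesic G d v)
    {i j : ℕ} (hi : i ≤ d) (hj : j ≤ d) (h : v i = v j) : i = j := by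
  have := hv.dist_eq hi hj
  rw [h, dist_self] at this
  omega

lemma IsGeodesic.reverse {G : SimpleGraph V} {d : ℕ} {v : ℕ → V} (hv : IsGeodesic G d v) :
    IsGeodesic G d (fun i => v (d - i)) := by
  intro i j hij hj
  rw [hv.dist_eq (by omega) (by omega)]
  omega

/-- In a tree, the distances from a vertex to the vertices of a geodesic are those of a vertex
hanging at distance `h` from the `j`-th vertex of the geodesic. -/
lemma IsGeodesic.exists_proj {T : SimpleGraph V} (hT : T.IsTree) {d : ℕ} {v : ℕ → V}
    (hv : IsGeodesic T d v) (w : V) :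
    ∃ j h, j ≤ d ∧ ∀ i ≤ d, T.dist w (v i) = h + (i - j) + (j - i) := by
  obtain ⟨j, hj, hmin⟩ := (Finset.range (d + 1)).exists_min_image (fun i => T.dist w (v i))
    ⟨0, by simp⟩
  simp only [Finset.mem_range] at hj hmin
  have step : ∀ i < d, T.dist w (v i) = T.dist w (v (i + 1)) + 1 ∨
      T.dist w (v (i + 1)) = T.dist w (v i) + 1 :=
    fun i hi => hT.dist_eq_dist_add_one_of_adj w (hv.adj hi)
  have peak : ∀ i, i + 2 ≤ d → T.dist w (v (i + 1)) = T.dist w (v i) + 1 →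
      T.dist w (v (i + 1)) ≠ T.dist w (v (i + 2)) + 1 := by
    intro i hi h1 h2
    have := hT.eq_of_adj_of_dist_eq (hv.adj (by omega)) (hv.adj (by omega : i + 1 < d)).symm h1 h2
    have := hv.injOn (by omega) hi this
    omega
  have right : ∀ k, j + k ≤ d → T.dist w (v (j + k)) = T.dist w (v j) + k ∧
      (j + k + 1 ≤ d → T.dist w (v (j + k + 1)) = T.dist w (v (j + k)) + 1) := by
    intro k
    induction k with
    | zero =>
      intro _
      refine ⟨rfl, fun h => ?_⟩
      have := hmin (j + 1) (by omega)
      have := step j (by omega)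
      simp only [add_zero]
      omega
    | succ k ih =>
      intro hk
      obtain ⟨h1, h2⟩ := ih (by omega)
      have h2 := h2 (by omega)
      refine ⟨by rw [← add_assoc]; omega, fun h => ?_⟩
      have : T.dist w (v (j + k + 1)) ≠ T.dist w (v (j + k + 1 + 1)) + 1 :=
        peak (j + k) (by omega) h2
      have := step (j + k + 1) (by omega)
      rw [← add_assoc]
      omega
  have left : ∀ k, k ≤ j → T.dist w (v (j - k)) = T.dist w (v j) + k ∧
      (k + 1 ≤ j → T.dist w (v (j - k - 1)) = T.dist w (v (j - k)) + 1) := by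
    intro k
    induction k with
    | zero =>
      intro _
      refine ⟨rfl, fun h => ?_⟩
      have := hmin (j - 1) (by omega)
      have := step (j - 1) (by omega)
      rw [show j - 1 + 1 = j by omega] at this
      simp only [Nat.sub_zero]
      omega
    | succ k ih =>
      intro hk
      obtain ⟨h1, h2⟩ := ih (by omega)
      have h2 := h2 (by omega)
      refine ⟨by rw [← Nat.sub_sub]; omega, fun h => ?_⟩
      have h3 := peak (j - k - 2) (by omega)
      have h4 := step (j - k - 2) (by omega)
      rw [show j - k - 2 + 2 = j - k by omega, show j - k - 2 + 1 = j - k - 1 by omega] at h3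
      rw [show j - k - 2 + 1 = j - k - 1 by omega] at h4
      rw [show j - (k + 1) - 1 = j - k - 2 by omega, show j - (k + 1) = j - k - 1 by omega]
      omega
  refine ⟨j, T.dist w (v j), by omega, fun i hi => ?_⟩
  rcases le_total i j with hij | hij
  · have := (left (j - i) (by omega)).1
    rw [show j - (j - i) = i by omega] at this
    omega
  · have := (right (i - j) (by omega)).1
    rw [show j + (i - j) = i by omega] at this
    omega

/-- Every distance in a connected graph is less than three times the size of a dominating set. -/
lemma dist_lt_three_mul_ncard [Finite V] {G : SimpleGraph V} (hG : G.Connected) {S : Set V}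
    (hS : ∀ v ∉ S, ∃ u ∈ S, G.Adj u v) (x y : V) : G.dist x y + 1 ≤ 3 * S.ncard := by
  classical
  obtain ⟨v, h0, -, hv⟩ := hG.exists_isGeodesic x y
  have hfin : S.Finite := S.toFinite
  have hsub : Finset.range (G.dist x y + 1) ⊆
      hfin.toFinset.biUnion fun s => {G.dist x s - 1, G.dist x s, G.dist x s + 1} := by
    intro i hi
    rw [Finset.mem_range] at hi
    have hxi : G.dist x (v i) = i := by
      rw [← h0, hv.dist_eq (by omega) (by omega)]; omega
    simp only [Finset.mem_biUnion, Set.Finite.mem_toFinset, Finset.mem_insert,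
      Finset.mem_singleton]
    by_cases hmem : v i ∈ S
    · exact ⟨v i, hmem, by omega⟩
    · obtain ⟨u, hu, hadj⟩ := hS _ hmem
      refine ⟨u, hu, ?_⟩
      have := hadj.diff_dist_adj (u := x)
      omega
  calc G.dist x y + 1 = (Finset.range (G.dist x y + 1)).card := by simp
    _ ≤ _ := Finset.card_le_card hsub
    _ ≤ hfin.toFinset.card * 3 := Finset.card_biUnion_le_card_mul _ _ _ fun s _ =>
        Finset.card_le_three
    _ = 3 * S.ncard := by rw [Set.ncard_eq_toFinset_card S hfin, mul_comm]

lemma exists_dominating_ncard_eq_domNumber (G : SimpleGraph V) :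
    ∃ S : Set V, (∀ v ∉ S, ∃ u ∈ S, G.Adj u v) ∧ S.ncard = domNumber G :=
  Nat.sInf_mem (s := {k | ∃ S : Set V, (∀ v ∉ S, ∃ u ∈ S, G.Adj u v) ∧ S.ncard = k})
    ⟨_, Set.univ, fun v hv => absurd (Set.mem_univ v) hv, rfl⟩

lemma minStatus_le [Fintype V] (G : SimpleGraph V) (u : V) : minStatus G ≤ status G u :=
  Nat.sInf_le ⟨u, rfl⟩

lemma sum_range_dist_center :
    ∀ d : ℕ, ∑ i ∈ Finset.range (d + 1), ((2 * i - d) + (d - 2 * i)) = (d + 1) ^ 2 / 2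
  | 0 => by simp
  | 1 => by simp [Finset.sum_range_succ]
  | d + 2 => by
    rw [Finset.sum_range_succ, Finset.sum_range_succ']
    have h : ∑ k ∈ Finset.range (d + 1), ((2 * (k + 1) - (d + 2)) + (d + 2 - 2 * (k + 1))) =
        (d + 1) ^ 2 / 2 := by
      rw [← sum_range_dist_center d]
      exact Finset.sum_congr rfl fun k _ => by omega
    rw [h, show (d + 2 + 1) ^ 2 = (d + 1) ^ 2 + 2 * (2 * d + 4) by ring,
      Nat.add_mul_div_left _ _ (by norm_num)]
    omega

/-- Twice the minimum status of a balanced dumbbell of order `n` and diameter `d`, up to rounding;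
in a tree of order `n` and diameter `d` it bounds the sum of the statuses of the two centers. -/
def centerBound (n d : ℕ) : ℕ := (d + 1) ^ 2 / 2 + (n - d - 1) * d

lemma centerBound_add_two_le_succ {n d : ℕ} (h : d + 3 ≤ n) :
    centerBound n d + 2 ≤ centerBound n (d + 1) := by
  obtain ⟨m, rfl⟩ := Nat.exists_eq_add_of_le h
  unfold centerBound
  rw [show d + 3 + m - d - 1 = m + 2 by omega, show d + 3 + m - (d + 1) - 1 = m + 1 by omega,
    show (d + 1 + 1) ^ 2 = (d + 1) ^ 2 + 1 + 2 * (d + 1) by ring,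
    Nat.add_mul_div_left _ _ (by norm_num)]
  have : (d + 1) ^ 2 / 2 ≤ ((d + 1) ^ 2 + 1) / 2 := by omega
  nlinarith

lemma centerBound_add_two_le {n d D : ℕ} (hd : d < D) (hD : D + 2 ≤ n) :
    centerBound n d + 2 ≤ centerBound n D := by
  induction D, hd using Nat.le_induction with
  | base => exact centerBound_add_two_le_succ (by omega)
  | succ D _ ih =>
    have := ih (by omega)
    have := centerBound_add_two_le_succ (n := n) (d := D) (by omega)
    omega

section Center

variable {T : SimpleGraph V} {d : ℕ} {v : ℕ → V}

lemma IsGeodesic.dist_center_add (hv : IsGeodesic T d v) {i : ℕ} (hi : i ≤ d) :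
    T.dist (v (d / 2)) (v i) + T.dist (v (d - d / 2)) (v i) = (2 * i - d) + (d - 2 * i) := by
  rw [hv.dist_eq (by omega) hi, hv.dist_eq (by omega) hi]
  omega

lemma IsGeodesic.exists_dist_center_add_eq (hT : T.IsTree) (hv : IsGeodesic T d v)
    (hd : ∀ x y, T.dist x y ≤ d) (w : V) :
    ∃ k, T.dist (v (d / 2)) w + T.dist (v (d - d / 2)) w + 2 * k = d := by
  obtain ⟨j, h, hj, hdist⟩ := hv.exists_proj hT w
  have h0 := hd w (v 0)
  have h1 := hd w (v d)
  rw [hdist _ (by omega)] at h0 h1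
  rw [dist_comm, hdist _ (by omega), dist_comm, hdist _ (by omega)]
  exact ⟨min j (d - j) - h, by omega⟩

variable [DecidableEq V]

lemma IsGeodesic.card_image (hv : IsGeodesic T d v) :
    ((Finset.range (d + 1)).image v).card = d + 1 := by
  rw [Finset.card_image_of_injOn, Finset.card_range]
  intro i hi j hj h
  simp only [Finset.coe_range, Set.mem_Iio] at hi hj
  exact hv.injOn (by omega) (by omega) h

lemma IsGeodesic.card_image_Ico (hv : IsGeodesic T d v) {k : ℕ} (hk : k ≤ d + 1) :
    ((Finset.Ico 1 k).image v).card = k - 1 := by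
  rw [Finset.card_image_of_injOn, Nat.card_Ico]
  intro i hi j hj h
  simp only [Finset.coe_Ico, Set.mem_Ico] at hi hj
  exact hv.injOn (by omega) (by omega) h

variable [Fintype V]

lemma IsGeodesic.status_center_add (hv : IsGeodesic T d v) :
    status T (v (d / 2)) + status T (v (d - d / 2)) = (d + 1) ^ 2 / 2 +
      ∑ w ∈ ((Finset.range (d + 1)).image v)ᶜ,
        (T.dist (v (d / 2)) w + T.dist (v (d - d / 2)) w) := by
  unfold status
  rw [← Finset.sum_add_distrib, ← Finset.sum_add_sum_compl ((Finset.range (d + 1)).image v),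
    Finset.sum_image, ← sum_range_dist_center d]
  · congr 1
    exact Finset.sum_congr rfl fun i hi => hv.dist_center_add (by simpa [Nat.lt_succ_iff] using hi)
  · intro i hi j hj h
    simp only [Finset.coe_range, Set.mem_Iio] at hi hj
    exact hv.injOn (by omega) (by omega) h

lemma IsGeodesic.status_center_add_le (hT : T.IsTree) (hv : IsGeodesic T d v)
    (hd : ∀ x y, T.dist x y ≤ d) :
    status T (v (d / 2)) + status T (v (d - d / 2)) ≤ centerBound (Fintype.card V) d := by
  rw [hv.status_center_add, centerBound]
  have := Finset.sum_le_card_nsmul ((Finset.range (d + 1)).image v)ᶜ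
    (fun w => T.dist (v (d / 2)) w + T.dist (v (d - d / 2)) w) d fun w _ => by
      obtain ⟨k, hk⟩ := hv.exists_dist_center_add_eq hT hd w
      omega
  rw [Finset.card_compl, hv.card_image, smul_eq_mul, ← Nat.sub_sub] at this
  omega

/-- If the bound on the statuses of the centers is attained up to one, then every vertex off the
geodesic is as far from the centers as possible. -/
lemma IsGeodesic.dist_center_add_eq (hT : T.IsTree) (hv : IsGeodesic T d v)
    (hd : ∀ x y, T.dist x y ≤ d)
    (hle : centerBound (Fintype.card V) d ≤
      status T (v (d / 2)) + status T (v (d - d / 2)) + 1)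
    {w : V} (hw : ∀ i ≤ d, w ≠ v i) :
    T.dist (v (d / 2)) w + T.dist (v (d - d / 2)) w = d := by
  by_contra hne
  obtain ⟨k, hk⟩ := hv.exists_dist_center_add_eq hT hd w
  have hmem : w ∈ ((Finset.range (d + 1)).image v)ᶜ := by
    simp only [Finset.mem_compl, Finset.mem_image, Finset.mem_range, not_exists, not_and]
    exact fun i hi h => hw i (by omega) h.symm
  have hsum := Finset.sum_le_card_nsmul (((Finset.range (d + 1)).image v)ᶜ.erase w)
    (fun w => T.dist (v (d / 2)) w + T.dist (v (d - d / 2)) w) d fun w _ => by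
      obtain ⟨k, hk⟩ := hv.exists_dist_center_add_eq hT hd w
      omega
  have hcard := Finset.card_erase_add_one hmem
  rw [Finset.card_compl, hv.card_image, ← Nat.sub_sub] at hcard
  rw [hv.status_center_add, centerBound, ← Finset.add_sum_erase _ _ hmem, ← hcard, add_mul,
    one_mul] at hle
  rw [smul_eq_mul] at hsum
  omega

/-- In the extremal case every vertex off the geodesic hangs from its second or its second to last
vertex. -/
lemma IsGeodesic.exists_proj_of_extremal (hT : T.IsTree) (hv : IsGeodesic T d v)
    (hd : ∀ x y, T.dist x y ≤ d)
    (hle : centerBound (Fintype.card V) d ≤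
      status T (v (d / 2)) + status T (v (d - d / 2)) + 1)
    {w : V} (hw : ∀ i ≤ d, w ≠ v i) :
    ∃ j, (j = 1 ∨ j + 1 = d) ∧ ∀ i ≤ d, T.dist w (v i) = 1 + (i - j) + (j - i) := by
  obtain ⟨j, h, hj, hdist⟩ := hv.exists_proj hT w
  have hpos : h ≠ 0 := by
    rintro rfl
    exact hw j hj (hT.connected.dist_eq_zero_iff.1 (by rw [hdist j hj]; omega))
  have heq : h = min j (d - j) := by
    have h0 := hd w (v 0)
    have h1 := hd w (v d)
    rw [hdist _ (by omega)] at h0 h1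
    have := hv.dist_center_add_eq hT hd hle hw
    rw [dist_comm, hdist _ (by omega), dist_comm, hdist _ (by omega)] at this
    omega
  suffices h1 : h = 1 by
    subst h1
    exact ⟨j, by omega, hdist⟩
  by_contra hne
  obtain ⟨g, hg0, hgd, hg⟩ := hT.connected.exists_isGeodesic w (v j)
  have hwj : T.dist w (v j) = h := by rw [hdist j hj]; omega
  have hwg : T.dist w (g 1) = 1 := by
    rw [← hg0, hg.dist_eq (by omega) (by omega)]
  have hgj : T.dist (g 1) (v j) + 1 ≤ h := by
    nth_rw 1 [← hgd]
    rw [hg.dist_eq (by omega) (by omega)]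
    omega
  have hdist' : ∀ i ≤ d, T.dist (g 1) (v i) = (h - 1) + (i - j) + (j - i) := by
    intro i hi
    have h1 := hT.connected.dist_triangle (u := w) (v := g 1) (w := v i)
    have h2 := hT.connected.dist_triangle (u := g 1) (v := v j) (w := v i)
    rw [hdist i hi] at h1
    rw [hv.dist_eq hj hi] at h2
    omega
  have hg1 : ∀ i ≤ d, g 1 ≠ v i := by
    intro i hi h1
    have := hdist' i hi
    rw [h1, dist_self] at this
    omega
  have := hv.dist_center_add_eq hT hd hle hg1
  rw [dist_comm, hdist' _ (by omega), dist_comm, hdist' _ (by omega)] at this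
  omega

end Center

section Dumbbell

variable {L p q : ℕ}

lemma dumbbell_adj {k l : Fin (L + p + q)} : (dumbbell (L + p + q) p q).Adj k l ↔ k ≠ l ∧
    ((((k : ℕ) + 1 = l ∧ (l : ℕ) < L) ∨ ((k : ℕ) = 0 ∧ L ≤ l ∧ (l : ℕ) < L + p) ∨
      ((k : ℕ) = L - 1 ∧ L + p ≤ l)) ∨
    (((l : ℕ) + 1 = k ∧ (k : ℕ) < L) ∨ ((l : ℕ) = 0 ∧ L ≤ k ∧ (k : ℕ) < L + p) ∨
      ((l : ℕ) = L - 1 ∧ L + p ≤ k))) := by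
  rw [dumbbell, fromRel_adj, show L + p + q - p - q = L by omega,
    show L + p + q - q = L + p by omega]

lemma dumbbell_connected (hL : 1 ≤ L) : (dumbbell (L + p + q) p q).Connected := by
  have hpath : ∀ k (hk : k < L),
      (dumbbell (L + p + q) p q).Reachable ⟨0, by omega⟩ ⟨k, by omega⟩ := by
    intro k
    induction k with
    | zero => exact fun _ => Reachable.refl _
    | succ k ih =>
      intro hk
      refine (ih (by omega)).trans (Adj.reachable ?_)
      exact dumbbell_adj.2 ⟨by simp, Or.inl (Or.inl ⟨rfl, hk⟩)⟩
  refine Connected.mk (nonempty := ⟨⟨0, by omega⟩⟩) fun a b => ?_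
  suffices h : ∀ a, (dumbbell (L + p + q) p q).Reachable ⟨0, by omega⟩ a from
    (h a).symm.trans (h b)
  rintro ⟨k, hk⟩
  by_cases h1 : k < L
  · exact hpath k h1
  by_cases h2 : k < L + p
  · refine Adj.reachable ?_
    exact dumbbell_adj.2 ⟨by simp only [ne_eq, Fin.mk.injEq]; omega,
      Or.inl (Or.inr (Or.inl ⟨rfl, not_lt.1 h1, h2⟩))⟩
  · refine (hpath (L - 1) (by omega)).trans (Adj.reachable ?_)
    exact dumbbell_adj.2 ⟨by simp only [ne_eq, Fin.mk.injEq]; omega,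
      Or.inl (Or.inr (Or.inr ⟨rfl, not_lt.1 h2⟩))⟩

/-- A tree made of a path `u 0, …, u (L - 1)`, a set `A` of neighbours of `u 0` and a set `B` of
neighbours of `u (L - 1)` is a dumbbell. -/
lemma nonempty_iso_dumbbell [Fintype V] {T : SimpleGraph V} (hT : T.IsTree)
    (hL : 1 ≤ L) (hn : Fintype.card V = L + p + q) {u : ℕ → V}
    (hinj : ∀ i < L, ∀ j < L, u i = u j → i = j) (hu : ∀ i, i + 1 < L → T.Adj (u i) (u (i + 1)))
    {A B : Finset V} (hA : A.card = p) (hB : B.card = q) (hAB : Disjoint A B)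
    (huA : ∀ i < L, u i ∉ A) (huB : ∀ i < L, u i ∉ B)
    (hadjA : ∀ w ∈ A, T.Adj (u 0) w) (hadjB : ∀ w ∈ B, T.Adj (u (L - 1)) w) :
    Nonempty (T ≃g dumbbell (L + p + q) p q) := by
  let a := (A.equivFinOfCardEq hA).symm
  let b := (B.equivFinOfCardEq hB).symm
  let φ : Fin (L + p + q) → V := fun k =>
    if h1 : (k : ℕ) < L then u k
    else if h2 : (k : ℕ) < L + p then a ⟨k - L, by omega⟩
    else b ⟨k - L - p, by omega⟩
  have φ1 : ∀ k : Fin (L + p + q), (k : ℕ) < L → φ k = u k := fun k h => by simp only [φ, dif_pos h]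
  have φ2 : ∀ k : Fin (L + p + q), (h1 : ¬ (k : ℕ) < L) → (h2 : (k : ℕ) < L + p) →
      φ k = a ⟨k - L, by omega⟩ := fun k h1 h2 => by simp only [φ, dif_neg h1, dif_pos h2]
  have φ3 : ∀ k : Fin (L + p + q), (h2 : ¬ (k : ℕ) < L + p) →
      φ k = b ⟨k - L - p, by omega⟩ := fun k h2 => by
    simp only [φ, dif_neg h2, dif_neg (fun h => h2 (by omega) : ¬ (k : ℕ) < L)]
  have hab : ∀ x y, (a x : V) ≠ b y := fun x y h =>
    Finset.disjoint_left.1 hAB (a x).2 (h ▸ (b y).2)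
  have hφ : Function.Injective φ := by
    intro k l hkl
    apply Fin.ext
    by_cases hk1 : (k : ℕ) < L
    · rw [φ1 k hk1] at hkl
      by_cases hl1 : (l : ℕ) < L
      · rw [φ1 l hl1] at hkl
        exact hinj _ hk1 _ hl1 hkl
      by_cases hl2 : (l : ℕ) < L + p
      · rw [φ2 l hl1 hl2] at hkl
        exact absurd (hkl ▸ (a _).2) (huA _ hk1)
      · rw [φ3 l hl2] at hkl
        exact absurd (hkl ▸ (b _).2) (huB _ hk1)
    by_cases hk2 : (k : ℕ) < L + p
    · rw [φ2 k hk1 hk2] at hkl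
      by_cases hl1 : (l : ℕ) < L
      · rw [φ1 l hl1] at hkl
        exact absurd (hkl ▸ (a _).2) (huA _ hl1)
      by_cases hl2 : (l : ℕ) < L + p
      · rw [φ2 l hl1 hl2] at hkl
        have := congrArg Fin.val (a.injective (Subtype.ext hkl))
        simp only at this
        omega
      · rw [φ3 l hl2] at hkl
        exact absurd hkl (hab _ _)
    · rw [φ3 k hk2] at hkl
      by_cases hl1 : (l : ℕ) < L
      · rw [φ1 l hl1] at hkl
        exact absurd (hkl ▸ (b _).2) (huB _ hl1)
      by_cases hl2 : (l : ℕ) < L + p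
      · rw [φ2 l hl1 hl2] at hkl
        exact absurd hkl.symm (hab _ _)
      · rw [φ3 l hl2] at hkl
        have := congrArg Fin.val (b.injective (Subtype.ext hkl))
        simp only at this
        omega
  let e : Fin (L + p + q) ≃ V := Equiv.ofBijective φ
    ((Fintype.bijective_iff_injective_and_card φ).2 ⟨hφ, by simp [hn]⟩)
  have hrel : ∀ k l : Fin (L + p + q),
      (((k : ℕ) + 1 = l ∧ (l : ℕ) < L) ∨ ((k : ℕ) = 0 ∧ L ≤ l ∧ (l : ℕ) < L + p) ∨
        ((k : ℕ) = L - 1 ∧ L + p ≤ l)) → T.Adj (φ k) (φ l) := by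
    rintro k l (⟨h1, h2⟩ | ⟨h1, h2, h3⟩ | ⟨h1, h2⟩)
    · rw [φ1 k (by omega), φ1 l (by omega), ← h1]
      exact hu _ (by omega)
    · rw [φ1 k (by omega), φ2 l (by omega) (by omega), h1]
      exact hadjA _ (a _).2
    · rw [φ1 k (by omega), φ3 l (by omega), h1]
      exact hadjB _ (b _).2
  have hle : dumbbell (L + p + q) p q ≤ T.comap e := by
    intro k l h
    rcases dumbbell_adj.1 h with ⟨-, h | h⟩
    · exact hrel k l h
    · exact (hrel l k h).symm
  have htree : (T.comap e).IsTree := (Iso.comap e T).isTree_iff.2 hT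
  have heq : T.comap e = dumbbell (L + p + q) p q :=
    le_antisymm ((isTree_iff_minimal_connected.1 htree).2 (dumbbell_connected hL) hle) hle
  exact ⟨heq ▸ (Iso.comap e T).symm⟩

lemma SimpleGraph.Connected.le_add_dist {G : SimpleGraph V} (hG : G.Connected) {f : V → ℕ}
    (hf : ∀ a b, G.Adj a b → f a ≤ f b + 1) (a b : V) : f a ≤ f b + G.dist a b := by
  obtain ⟨w, hw⟩ := hG.exists_walk_length_eq_dist a b
  rw [← hw]
  clear hw
  induction w with
  | nil => simp
  | cons h w ih =>
    have := hf _ _ h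
    rw [Walk.length_cons]
    omega

lemma sq_div_four_le_sum_range :
    ∀ N t : ℕ, N ^ 2 / 4 ≤ ∑ i ∈ Finset.range N, ((i - t) + (t - i))
  | 0, _ => by simp
  | 1, _ => by simp
  | N + 2, t => by
    rw [Finset.sum_range_succ, Finset.sum_range_succ']
    have h := sq_div_four_le_sum_range N (t - 1)
    have h' : ∑ i ∈ Finset.range N, ((i - (t - 1)) + (t - 1 - i)) ≤
        ∑ i ∈ Finset.range N, ((i + 1 - t) + (t - (i + 1))) :=
      Finset.sum_le_sum fun i _ => by omega
    rw [show (N + 2) ^ 2 = N ^ 2 + 4 * (N + 1) by ring, Nat.add_mul_div_left _ _ (by norm_num)]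
    omega

/-- The distance sum of a balanced dumbbell, measured along its axis, from any position `t`. -/
lemma centerBound_le_axis_sum {t : ℕ} (hqp : q ≤ p) (hpq : p ≤ q + 1) (hp : 2 ≤ p + q)
    (ht : t ≤ L + 1) :
    centerBound (L + p + q) (L + 1) ≤
      2 * (∑ i ∈ Finset.range L, ((i + 1 - t) + (t - (i + 1))) + p * t + q * (L + 1 - t)) + 1 := by
  obtain ⟨s, hs⟩ := Nat.exists_eq_add_of_le ht
  unfold centerBound
  rw [show L + 1 - t = s by omega, show L + p + q - (L + 1) - 1 = p + q - 2 by omega]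
  obtain rfl | rfl : p = q ∨ p = q + 1 := by omega
  · obtain ⟨r, rfl⟩ := Nat.exists_eq_add_of_le (show 1 ≤ p by omega)
    have h := sq_div_four_le_sum_range L (t - 1)
    have h' : ∑ i ∈ Finset.range L, ((i - (t - 1)) + (t - 1 - i)) ≤
        ∑ i ∈ Finset.range L, ((i + 1 - t) + (t - (i + 1))) :=
      Finset.sum_le_sum fun i _ => by omega
    have hmul : (1 + r) * t + (1 + r) * s = (1 + r) * (L + 1) := by rw [hs]; ring
    rw [show 1 + r + (1 + r) - 2 = 2 * r by omega,
      show (L + 1 + 1) ^ 2 = L ^ 2 + 2 * (2 * (L + 1)) by ring,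
      Nat.add_mul_div_left _ _ (by norm_num), mul_assoc]
    rw [add_mul 1 r (L + 1)] at hmul
    omega
  · obtain ⟨r, rfl⟩ := Nat.exists_eq_add_of_le (show 1 ≤ q by omega)
    have h := sq_div_four_le_sum_range (L + 1) t
    rw [Finset.sum_range_succ'] at h
    have hmul : (1 + r + 1) * t + (1 + r) * s = (1 + r) * (L + 1) + t := by rw [hs]; ring
    rw [show 1 + r + 1 + (1 + r) - 2 = 2 * r + 1 by omega,
      show (L + 1 + 1) ^ 2 = (L + 1) ^ 2 + 1 + 2 * (L + 1) by ring,
      Nat.add_mul_div_left _ _ (by norm_num), add_mul (2 * r), mul_assoc]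
    rw [add_mul 1 r (L + 1)] at hmul
    have hmod : (L + 1) ^ 2 % 4 = 0 ∨ (L + 1) ^ 2 % 4 = 1 := by
      rw [Nat.pow_mod]
      have : (L + 1) % 4 < 4 := Nat.mod_lt _ (by norm_num)
      interval_cases (L + 1) % 4 <;> simp
    omega

lemma centerBound_le_of_iso_dumbbell [Fintype V] {T : SimpleGraph V} (hT : T.Connected)
    (hqp : q ≤ p) (hpq : p ≤ q + 1) (hp : 2 ≤ p + q)
    (e : T ≃g dumbbell (L + p + q) p q) :
    centerBound (L + p + q) (L + 1) ≤ 2 * minStatus T + 1 := by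
  let f : ℕ → ℕ := fun k => if k < L then k + 1 else if k < L + p then 0 else L + 1
  have f1 : ∀ k < L, f k = k + 1 := fun k h => by simp [f, h]
  have f2 : ∀ k, L ≤ k → k < L + p → f k = 0 := fun k h h' => by
    simp [f, h', not_lt.2 h]
  have f3 : ∀ k, L + p ≤ k → f k = L + 1 := fun k h => by
    simp [f, not_lt.2 h, not_lt.2 (show L ≤ k by omega)]
  have hadj : ∀ a b, T.Adj a b → f (e a) ≤ f (e b) + 1 := by
    intro a b h
    have := dumbbell_adj.1 (e.map_adj_iff.2 h)
    have ha := (e a).2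
    have hb := (e b).2
    simp only [f]
    split_ifs <;> omega
  have := hT.nonempty
  obtain ⟨u, hu⟩ : ∃ u, status T u = minStatus T :=
    Nat.sInf_mem (Set.range_nonempty (status T))
  have hfu : f (e u) ≤ L + 1 := by
    simp only [f]
    split_ifs <;> omega
  refine (centerBound_le_axis_sum hqp hpq hp hfu).trans ?_
  have hsum : ∑ w, ((f (e w) - f (e u)) + (f (e u) - f (e w))) ≤ status T u :=
    Finset.sum_le_sum fun w _ => by
      have h1 := hT.le_add_dist hadj w u
      have h2 := hT.le_add_dist hadj u w
      rw [dist_comm] at h1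
      omega
  have hcomp : ∑ w, ((f (e w) - f (e u)) + (f (e u) - f (e w))) =
      ∑ k : Fin (L + p + q), ((f k - f (e u)) + (f (e u) - f k)) :=
    Equiv.sum_comp e.toEquiv fun k : Fin (L + p + q) => (f k - f (e u)) + (f (e u) - f k)
  rw [hu, hcomp,
    Fin.sum_univ_eq_sum_range (fun k => (f k - f (e u)) + (f (e u) - f k)),
    Finset.sum_range_add, Finset.sum_range_add] at hsum
  have s1 : ∑ k ∈ Finset.range L, ((f k - f (e u)) + (f (e u) - f k)) =
      ∑ k ∈ Finset.range L, ((k + 1 - f (e u)) + (f (e u) - (k + 1))) :=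
    Finset.sum_congr rfl fun k hk => by rw [f1 k (Finset.mem_range.1 hk)]
  have s2 : ∑ k ∈ Finset.range p, ((f (L + k) - f (e u)) + (f (e u) - f (L + k))) =
      p * f (e u) := by
    rw [Finset.sum_congr rfl fun k hk => by
      rw [f2 (L + k) (by omega) (by have := Finset.mem_range.1 hk; omega)]]
    simp
  have s3 : ∑ k ∈ Finset.range q, ((f (L + p + k) - f (e u)) + (f (e u) - f (L + p + k))) =
      q * (L + 1 - f (e u)) := by
    rw [Finset.sum_congr rfl fun k _ => by rw [f3 (L + p + k) (by omega)]]
    simp [Nat.sub_eq_zero_of_le hfu]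
  omega

end Dumbbell

section Extremal

variable [Fintype V] {T : SimpleGraph V} {d : ℕ} {v : ℕ → V}

open Classical in
/-- The vertices that hang from the second vertex of the geodesic `v 0, …, v d`. -/
noncomputable def endLeaves (T : SimpleGraph V) (d : ℕ) (v : ℕ → V) : Finset V :=
  {w | ∀ i, 1 ≤ i → i < d → T.dist w (v i) = i}

lemma mem_endLeaves {w : V} :
    w ∈ endLeaves T d v ↔ ∀ i, 1 ≤ i → i < d → T.dist w (v i) = i := by
  simp [endLeaves]

lemma notMem_endLeaves {i : ℕ} (h1 : 1 ≤ i) (hi : i < d) : v i ∉ endLeaves T d v := by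
  intro h
  have := mem_endLeaves.1 h i h1 hi
  rw [dist_self] at this
  omega

lemma endLeaves_reverse_reverse :
    endLeaves T d (fun i => v (d - (d - i))) = endLeaves T d v := by
  ext w
  simp only [mem_endLeaves]
  refine forall_congr' fun i => forall_congr' fun _ => forall_congr' fun hi => ?_
  rw [show d - (d - i) = i by omega]

lemma disjoint_endLeaves_reverse (hd3 : 3 ≤ d) :
    Disjoint (endLeaves T d v) (endLeaves T d fun i => v (d - i)) := by
  rw [Finset.disjoint_left]
  intro w h1 h2
  have h1 := mem_endLeaves.1 h1 1 le_rfl (by omega)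
  have h2 := mem_endLeaves.1 h2 (d - 1) (by omega) (by omega)
  rw [show d - (d - 1) = 1 by omega] at h2
  omega

lemma IsGeodesic.exists_or_mem_endLeaves (hT : T.IsTree) (hv : IsGeodesic T d v)
    (hd : ∀ x y, T.dist x y ≤ d)
    (hext : centerBound (Fintype.card V) d ≤ 2 * minStatus T + 1) (w : V) :
    (∃ i, 1 ≤ i ∧ i < d ∧ v i = w) ∨ w ∈ endLeaves T d v ∨
      w ∈ endLeaves T d fun i => v (d - i) := by
  classical
  simp only [mem_endLeaves]
  by_cases hw : ∀ i ≤ d, w ≠ v i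
  · have h1 := minStatus_le T (v (d / 2))
    have h2 := minStatus_le T (v (d - d / 2))
    obtain ⟨j, hj | hj, hdist⟩ := hv.exists_proj_of_extremal hT hd (by omega) hw
    · refine Or.inr (Or.inl fun i _ hi => ?_)
      rw [hdist i hi.le]
      omega
    · refine Or.inr (Or.inr fun i _ hi => ?_)
      rw [hdist (d - i) (by omega)]
      omega
  · push Not at hw
    obtain ⟨i, hi, rfl⟩ := hw
    rcases Nat.eq_zero_or_pos i with rfl | hpos
    · refine Or.inr (Or.inl fun i _ hi => ?_)
      rw [hv.dist_eq (by omega) (by omega)]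
      omega
    rcases hi.eq_or_lt with rfl | hlt
    · refine Or.inr (Or.inr fun j _ hj => ?_)
      rw [hv.dist_eq (by omega) (by omega)]
      omega
    · exact Or.inl ⟨i, hpos, hlt, rfl⟩

lemma notMem_endLeaves_reverse {i : ℕ} (h1 : 1 ≤ i) (hi : i < d) :
    v i ∉ endLeaves T d fun i => v (d - i) := by
  have := notMem_endLeaves (T := T) (v := fun i => v (d - i)) (i := d - i) (d := d)
    (by omega) (by omega)
  rwa [show d - (d - i) = i by omega] at this

lemma IsGeodesic.nonempty_iso_dumbbell_of_leaves (hT : T.IsTree) (hv : IsGeodesic T d v)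
    {p q : ℕ} (hd2 : 2 ≤ d) (hcard : Fintype.card V = (d - 1) + p + q)
    {A B : Finset V} (hA : A.card = p) (hB : B.card = q) (hAB : Disjoint A B)
    (hvA : ∀ i, 1 ≤ i → i < d → v i ∉ A) (hvB : ∀ i, 1 ≤ i → i < d → v i ∉ B)
    (hadjA : ∀ w ∈ A, T.dist w (v 1) = 1) (hadjB : ∀ w ∈ B, T.dist w (v (d - 1)) = 1) :
    Nonempty (T ≃g dumbbell (d - 1 + p + q) p q) := by
  refine nonempty_iso_dumbbell hT (by omega) hcard (u := fun i => v (i + 1)) ?_ ?_ hA hB hAB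
    (fun i hi => hvA _ (by omega) (by omega)) (fun i hi => hvB _ (by omega) (by omega))
    (fun w hw => (dist_eq_one_iff_adj.1 (hadjA w hw)).symm) ?_
  · intro i hi j hj h
    have := hv.injOn (by omega) (by omega) h
    omega
  · exact fun i hi => hv.adj (by omega)
  · intro w hw
    rw [show d - 1 - 1 + 1 = d - 1 by omega]
    exact (dist_eq_one_iff_adj.1 (hadjB w hw)).symm

variable [DecidableEq V]

lemma disjoint_image_Ico_endLeaves {k : ℕ} (hk : k ≤ d) :
    Disjoint ((Finset.Ico 1 k).image v) (endLeaves T d v) := by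
  rw [Finset.disjoint_left]
  intro w hw
  obtain ⟨i, hi, rfl⟩ := Finset.mem_image.1 hw
  rw [Finset.mem_Ico] at hi
  exact notMem_endLeaves hi.1 (by omega)

lemma IsGeodesic.card_eq_of_extremal (hT : T.IsTree) (hv : IsGeodesic T d v) (hd3 : 3 ≤ d)
    (hd : ∀ x y, T.dist x y ≤ d)
    (hext : centerBound (Fintype.card V) d ≤ 2 * minStatus T + 1) :
    Fintype.card V =
      d - 1 + (endLeaves T d v).card + (endLeaves T d fun i => v (d - i)).card := by
  rw [← hv.card_image_Ico (k := d) (by omega),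
    ← Finset.card_union_of_disjoint (disjoint_image_Ico_endLeaves le_rfl),
    ← Finset.card_union_of_disjoint, ← Finset.card_univ]
  · congr 1
    symm
    rw [Finset.eq_univ_iff_forall]
    intro w
    simp only [Finset.mem_union, Finset.mem_image, Finset.mem_Ico, or_assoc, and_assoc]
    exact hv.exists_or_mem_endLeaves hT hd hext w
  · refine Finset.disjoint_union_left.2 ⟨?_, disjoint_endLeaves_reverse hd3⟩
    rw [Finset.disjoint_left]
    intro w hw
    obtain ⟨i, hi, rfl⟩ := Finset.mem_image.1 hw
    rw [Finset.mem_Ico] at hi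
    exact notMem_endLeaves_reverse hi.1 hi.2

/-- In an extremal tree neither end of the geodesic has two more leaves than the other one. -/
lemma IsGeodesic.card_endLeaves_le (hT : T.IsTree) (hv : IsGeodesic T d v) (hd3 : 3 ≤ d)
    (hd : ∀ x y, T.dist x y ≤ d)
    (hext : centerBound (Fintype.card V) d ≤ 2 * minStatus T + 1) :
    (endLeaves T d v).card ≤ (endLeaves T d fun i => v (d - i)).card + 1 := by
  have hcard := hv.card_eq_of_extremal hT hd3 hd hext
  obtain ⟨i, hi⟩ : ∃ i, i = (d - 1) / 2 := ⟨_, rfl⟩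
  let X := (Finset.Ico 1 (i + 1)).image v ∪ endLeaves T d v
  have hX : X.card = i + (endLeaves T d v).card := by
    rw [Finset.card_union_of_disjoint (disjoint_image_Ico_endLeaves (by omega)),
      hv.card_image_Ico (by omega), Nat.add_sub_cancel]
  have hsum : status T (v i) + 2 * X.card ≤ status T (v (i + 1)) + Fintype.card V := by
    have hle : ∑ w, (T.dist (v i) w + if w ∈ X then 2 else 0) ≤
        ∑ w, (T.dist (v (i + 1)) w + 1) := by
      refine Finset.sum_le_sum fun w _ => ?_
      split_ifs with hw
      · rcases Finset.mem_union.1 hw with hw | hw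
        · obtain ⟨j, hj, rfl⟩ := Finset.mem_image.1 hw
          rw [Finset.mem_Ico] at hj
          rw [hv.dist_eq (by omega) (by omega), hv.dist_eq (by omega) (by omega)]
          omega
        · rw [dist_comm, mem_endLeaves.1 hw i (by omega) (by omega), dist_comm,
            mem_endLeaves.1 hw (i + 1) (by omega) (by omega)]
      · have h1 := hT.connected.dist_triangle (u := v i) (v := v (i + 1)) (w := w)
        rw [dist_eq_one_iff_adj.2 (hv.adj (by omega))] at h1
        omega
    simp only [Finset.sum_add_distrib, Finset.sum_ite_mem, Finset.univ_inter, Finset.sum_const,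
      Finset.card_univ, smul_eq_mul, mul_one] at hle
    unfold status
    omega
  have hctr := hv.status_center_add_le hT hd
  have hmin := minStatus_le T (v i)
  rcases Nat.even_or_odd' d with ⟨m, hm | hm⟩
  · rw [show d / 2 = i + 1 by omega, show d - (i + 1) = i + 1 by omega] at hctr
    omega
  · rw [show d / 2 = i by omega, show d - i = i + 1 by omega] at hctr
    omega

/-- An extremal tree of diameter `d` is a balanced dumbbell. -/
lemma IsGeodesic.exists_iso_of_extremal (hT : T.IsTree) (hv : IsGeodesic T d v)
    (hd2 : 2 ≤ d) (hn : d + 2 ≤ Fintype.card V) (hd : ∀ x y, T.dist x y ≤ d)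
    (hext : centerBound (Fintype.card V) d ≤ 2 * minStatus T + 1) :
    ∃ p q, q ≤ p ∧ p ≤ q + 1 ∧ Fintype.card V = (d - 1) + p + q ∧
      Nonempty (T ≃g dumbbell (d - 1 + p + q) p q) := by
  rcases hd2.eq_or_lt with rfl | hd3
  · have hall : ∀ w ∈ ({v 1}ᶜ : Finset V), T.dist w (v 1) = 1 := by
      intro w hw
      rw [Finset.mem_compl, Finset.mem_singleton] at hw
      rcases hv.exists_or_mem_endLeaves hT hd hext w with ⟨i, h1, h2, rfl⟩ | h | h
      · exact absurd (by rw [show i = 1 by omega]) hw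
      · exact mem_endLeaves.1 h 1 le_rfl (by omega)
      · exact mem_endLeaves.1 h 1 le_rfl (by omega)
    have hc : ({v 1}ᶜ : Finset V).card = Fintype.card V - 1 := by
      rw [Finset.card_compl, Finset.card_singleton]
    obtain ⟨A, hAsub, hA⟩ := Finset.exists_subset_card_eq
      (show Fintype.card V / 2 ≤ ({v 1}ᶜ : Finset V).card by omega)
    have hB := Finset.card_sdiff_of_subset hAsub
    refine ⟨_, _, ?_, ?_, ?_, hv.nonempty_iso_dumbbell_of_leaves hT le_rfl ?_ hA hB
      Finset.disjoint_sdiff (fun i h1 h2 h => ?_) (fun i h1 h2 h => ?_)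
      (fun w hw => hall w (hAsub hw)) (fun w hw => hall w (Finset.sdiff_subset hw))⟩
    · omega
    · omega
    · omega
    · omega
    · exact Finset.mem_compl.1 (hAsub h) (by rw [show i = 1 by omega]; simp)
    · exact Finset.mem_compl.1 (Finset.sdiff_subset h) (by rw [show i = 1 by omega]; simp)
  · have hcard := hv.card_eq_of_extremal hT hd3 hd hext
    have hle := hv.card_endLeaves_le hT hd3 hd hext
    have hle' := hv.reverse.card_endLeaves_le hT hd3 hd hext
    rw [endLeaves_reverse_reverse] at hle'
    have hdist : ∀ w ∈ endLeaves T d v, T.dist w (v 1) = 1 :=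
      fun w hw => mem_endLeaves.1 hw 1 le_rfl (by omega)
    have hdist' : ∀ w ∈ endLeaves T d (fun i => v (d - i)), T.dist w (v (d - 1)) = 1 :=
      fun w hw => mem_endLeaves.1 hw 1 le_rfl (by omega)
    rcases le_total (endLeaves T d fun i => v (d - i)).card (endLeaves T d v).card with h | h
    · exact ⟨_, _, h, hle, hcard, hv.nonempty_iso_dumbbell_of_leaves hT hd2 hcard rfl rfl
        (disjoint_endLeaves_reverse hd3) (fun _ => notMem_endLeaves)
        (fun _ => notMem_endLeaves_reverse) hdist hdist'⟩
    · refine ⟨_, _, h, hle', by omega, hv.reverse.nonempty_iso_dumbbell_of_leaves hT hd2 (by omega)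
        rfl rfl (disjoint_endLeaves_reverse hd3).symm (fun _ => notMem_endLeaves)
        (fun i h1 h2 => notMem_endLeaves (by omega) (by omega)) hdist' ?_⟩
      rwa [show d - (d - 1) = 1 by omega]

end Extremal

/-- A tree of order `n` and diameter at most `D` has minimum status at most that of the balanced
dumbbell of order `n` and diameter `D`, which is the only extremal tree. -/
theorem minStatus_le_centerBound [Fintype V] {T : SimpleGraph V} (hT : T.IsTree) {D : ℕ}
    (hD2 : 2 ≤ D) (hn : D + 2 ≤ Fintype.card V) (hD : ∀ x y, T.dist x y ≤ D) :
    minStatus T ≤ centerBound (Fintype.card V) D / 2 ∧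
      (minStatus T = centerBound (Fintype.card V) D / 2 ↔
        Nonempty (T ≃g dumbbell (Fintype.card V) ((Fintype.card V - D + 2) / 2)
          ((Fintype.card V - D + 1) / 2))) := by
  classical
  have := hT.connected.nonempty
  obtain ⟨⟨x, y⟩, hxy⟩ := Finite.exists_max fun z : V × V => T.dist z.1 z.2
  obtain ⟨v, -, -, hv⟩ := hT.connected.exists_isGeodesic x y
  have hd : ∀ a b, T.dist a b ≤ T.dist x y := fun a b => hxy (a, b)
  have hle := hv.status_center_add_le hT hd
  have h1 := minStatus_le T (v (T.dist x y / 2))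
  have h2 := minStatus_le T (v (T.dist x y - T.dist x y / 2))
  have hlt : T.dist x y < D →
      centerBound (Fintype.card V) (T.dist x y) + 2 ≤ centerBound (Fintype.card V) D :=
    fun h => centerBound_add_two_le h hn
  have hub : minStatus T ≤ centerBound (Fintype.card V) D / 2 := by
    rcases (hD x y).eq_or_lt with h | h
    · rw [h] at hle h1 h2
      omega
    · have := hlt h
      omega
  refine ⟨hub, fun heq => ?_, fun ⟨e⟩ => ?_⟩
  · have hxD : T.dist x y = D := by
      rcases (hD x y).eq_or_lt with h | h
      · exact h
      · have := hlt h
        omega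
    rw [hxD] at hv
    obtain ⟨p, q, hqp, hpq, hcard, hiso⟩ := hv.exists_iso_of_extremal hT hD2 hn hD (by omega)
    rw [hcard]
    rwa [show (D - 1 + p + q - D + 2) / 2 = p by omega,
      show (D - 1 + p + q - D + 1) / 2 = q by omega]
  · obtain ⟨p, hp⟩ : ∃ p, p = (Fintype.card V - D + 2) / 2 := ⟨_, rfl⟩
    obtain ⟨q, hq⟩ : ∃ q, q = (Fintype.card V - D + 1) / 2 := ⟨_, rfl⟩
    have hcard : Fintype.card V = D - 1 + p + q := by omega
    rw [← hp, ← hq, hcard] at e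
    have := centerBound_le_of_iso_dumbbell hT.connected (by omega) (by omega) (by omega) e
    rw [← hcard, show D - 1 + 1 = D by omega] at this
    omega

lemma centerBound_two_mul_div_two {n k : ℕ} (h : 2 * k + 1 ≤ n) :
    centerBound n (2 * k) / 2 = k * (n - k) := by
  obtain ⟨m, rfl⟩ := Nat.exists_eq_add_of_le h
  unfold centerBound
  rw [show 2 * k + 1 + m - 2 * k - 1 = m by omega, show 2 * k + 1 + m - k = k + 1 + m by omega,
    show (2 * k + 1) ^ 2 = 1 + 2 * (2 * (k * (k + 1))) by ring,
    Nat.add_mul_div_left _ _ (by norm_num),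
    show 1 / 2 + 2 * (k * (k + 1)) + m * (2 * k) = 2 * (k * (k + 1 + m)) by ring]
  exact Nat.mul_div_cancel_left _ (by norm_num)

lemma centerBound_two_mul_sub_one_div_two {n m : ℕ} (hm : 1 ≤ m) (h : 2 * m ≤ n) :
    centerBound n (2 * m - 1) / 2 = m * (n + 1 - m) - (n + 1) / 2 := by
  obtain ⟨r, rfl⟩ := Nat.exists_eq_add_of_le h
  obtain ⟨l, rfl⟩ := Nat.exists_eq_add_of_le hm
  unfold centerBound
  rw [show 2 * (1 + l) + r - (2 * (1 + l) - 1) - 1 = r by omega,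
    show 2 * (1 + l) + r + 1 - (1 + l) = l + 2 + r by omega,
    show 2 * (1 + l) - 1 + 1 = 2 * (1 + l) by omega,
    show (2 * (1 + l)) ^ 2 = 2 * (2 * (1 + l) ^ 2) by ring,
    Nat.mul_div_cancel_left _ (by norm_num), show 2 * (1 + l) - 1 = 2 * l + 1 by omega]
  have key : 2 * ((1 + l) * (l + 2 + r)) =
      2 * (1 + l) ^ 2 + r * (2 * l + 1) + (2 * (1 + l) + r) := by ring
  omega

/-- Upper bound on the minimum status of a tree with order `n` and domination
number `γ < ⌈n/3⌉`, with equality iff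
`T ≅ D_n(⌈(n-3γ+2)/2⌉, ⌊(n-3γ+2)/2⌋)`. -/
theorem stmt9 [Fintype V] (T : SimpleGraph V) (n γ : ℕ)
    (hn : Fintype.card V = n) (hT : T.IsTree)
    (hγ : domNumber T = γ) (h1 : 1 ≤ γ) (h2 : γ < (n + 2) / 3) :
    (Odd γ →
      minStatus T ≤ ((3 * γ - 1) / 2) * (n - (3 * γ - 1) / 2) ∧
      (minStatus T = ((3 * γ - 1) / 2) * (n - (3 * γ - 1) / 2) ↔
        Nonempty (T ≃g dumbbell n ((n - 3 * γ + 3) / 2) ((n - 3 * γ + 2) / 2)))) ∧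
    (Even γ →
      minStatus T ≤ (3 * γ / 2) * (n + 1 - 3 * γ / 2) - (n + 1) / 2 ∧
      (minStatus T = (3 * γ / 2) * (n + 1 - 3 * γ / 2) - (n + 1) / 2 ↔
        Nonempty (T ≃g dumbbell n ((n - 3 * γ + 3) / 2) ((n - 3 * γ + 2) / 2)))) := by
  obtain ⟨S, hS, hScard⟩ := exists_dominating_ncard_eq_domNumber T
  have hD : ∀ x y, T.dist x y ≤ 3 * γ - 1 := by
    intro x y
    have := dist_lt_three_mul_ncard hT.connected hS x y
    omega
  have hmain := minStatus_le_centerBound hT (by omega) (by omega) hD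
  rw [hn, show n - (3 * γ - 1) + 2 = n - 3 * γ + 3 by omega,
    show n - (3 * γ - 1) + 1 = n - 3 * γ + 2 by omega] at hmain
  refine ⟨?_, ?_⟩
  · rintro ⟨g, rfl⟩
    have h := centerBound_two_mul_div_two (n := n) (k := 3 * g + 1) (by omega)
    rw [show 3 * (2 * g + 1) - 1 = 2 * (3 * g + 1) by omega,
      Nat.mul_div_cancel_left _ (by norm_num), ← h]
    rwa [show 3 * (2 * g + 1) - 1 = 2 * (3 * g + 1) by omega] at hmain
  · rintro ⟨g, rfl⟩
    have h := centerBound_two_mul_sub_one_div_two (n := n) (m := 3 * g) (by omega) (by omega)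
    rw [show 3 * (g + g) / 2 = 3 * g by omega, ← h]
    rwa [show 3 * (g + g) - 1 = 2 * (3 * g) - 1 by omega] at hmain
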